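/- For all integers n ≥ m ≥ 0 and every real c ≥ 0, π(X_n − X_m ≥ c) ≤ π(X_{n−m} ≥ c); that is, the positive part of the increment X_n − X_m is stochastically dominated by the positive part of X_{n−m}. -/

import Mathlib

open MeasureTheory
open scoped ENNReal

/-- Nearest-neighbour paths in `ℕ` started at `0`. -/
def IsWalk (h : ℕ → ℕ) : Prop :=
  h 0 = 0 ∧ ∀ n : ℕ, |((h (n + 1) : ℤ)) - (h n : ℤ)| = 1

/-- The sequences that agree with `h` at the times `1, …, N`. -/
def walkCylinder (N : ℕ) (h : ℕ → ℕ) : Set (ℕ → ℕ) :=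
  {g | ∀ i, 1 ≤ i → i ≤ N → g i = h i}

/-- Follow `h` up to time `N`, jump to `x` at time `N + 1`, and go up forever after. -/
def extendWalk (h : ℕ → ℕ) (N x : ℕ) : ℕ → ℕ :=
  fun i => if i ≤ N then h i else x + (i - (N + 1))

/-- The probability that the walk conditioned to stay nonnegative, started at `x`, is at least `a`
after `t` steps. -/
noncomputable def walkTail : ℕ → ℝ → ℕ → ℝ
  | 0, a, x => if a ≤ x then 1 else 0
  | t + 1, a, x => ((x : ℝ) + 2) / (2 * (x + 1)) * walkTail t a (x + 1)
      + (x : ℝ) / (2 * (x + 1)) * walkTail t a (x - 1)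

/-- An average of `a, b` with weight `p` on `a` is at most the average of `A, B` with weight `q`
on `A`, provided `a ≤ A`, `b ≤ B ≤ A` and `p ≤ q`. -/
lemma average_le_average {p q a b A B : ℝ} (hp : 0 ≤ p) (hp1 : p ≤ 1) (hpq : p ≤ q)
    (ha : a ≤ A) (hb : b ≤ B) (hBA : B ≤ A) :
    p * a + (1 - p) * b ≤ q * A + (1 - q) * B := by
  nlinarith [mul_le_mul_of_nonneg_left ha hp, mul_le_mul_of_nonneg_left hb (sub_nonneg.2 hp1),
    mul_nonneg (sub_nonneg.2 hpq) (sub_nonneg.2 hBA)]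

lemma upProb_nonneg (x : ℕ) : (0 : ℝ) ≤ ((x : ℝ) + 2) / (2 * (x + 1)) := by positivity

lemma upProb_le_one (x : ℕ) : ((x : ℝ) + 2) / (2 * (x + 1)) ≤ 1 := by
  rw [div_le_one (by positivity)]
  linarith [(Nat.cast_nonneg x : (0 : ℝ) ≤ x)]

lemma upProb_anti {x z : ℕ} (h : z ≤ x) :
    ((x : ℝ) + 2) / (2 * (x + 1)) ≤ ((z : ℝ) + 2) / (2 * (z + 1)) := by
  have h' : (z : ℝ) ≤ x := by exact_mod_cast h
  rw [div_le_div_iff₀ (by positivity) (by positivity)]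
  nlinarith

lemma walkTail_succ (t : ℕ) (a : ℝ) (x : ℕ) :
    walkTail (t + 1) a x = ((x : ℝ) + 2) / (2 * (x + 1)) * walkTail t a (x + 1)
      + (1 - ((x : ℝ) + 2) / (2 * (x + 1))) * walkTail t a (x - 1) := by
  have : (x : ℝ) / (2 * (x + 1)) = 1 - ((x : ℝ) + 2) / (2 * (x + 1)) := by
    field_simp
    ring
  rw [walkTail, this]

/-- The walk started at `x`, minus `k`, is dominated by the walk started at `z ≥ x - k` of the
same parity. -/
lemma walkTail_le (c : ℝ) (t : ℕ) : ∀ x z k : ℕ, x ≤ z + k → x % 2 = (z + k) % 2 →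
    walkTail t (c + k) x ≤ walkTail t c z := by
  induction t with
  | zero =>
    intro x z k hle _
    have hle' : (x : ℝ) ≤ z + k := by exact_mod_cast hle
    simp only [walkTail]
    split_ifs <;> linarith
  | succ t ih =>
    intro x z k hle hpar
    rw [walkTail_succ t _ x, walkTail_succ t _ z]
    set p : ℝ := ((x : ℝ) + 2) / (2 * (x + 1)) with hp
    set q : ℝ := ((z : ℝ) + 2) / (2 * (z + 1)) with hq
    have hp0 : 0 ≤ p := upProb_nonneg x
    have hp1 : p ≤ 1 := upProb_le_one x
    have hq0 : 0 ≤ q := upProb_nonneg z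
    have hq1 : q ≤ 1 := upProb_le_one z
    have hup := ih (x + 1) (z + 1) k (by omega) (by omega)
    rcases Nat.eq_zero_or_pos z with rfl | hz
    · have hq' : q = 1 := by simp [hq]
      rcases Nat.eq_zero_or_pos x with rfl | hx
      · have hp' : p = 1 := by simp [hp]
        simpa [hp', hq'] using hup
      · have := ih (x - 1) 1 k (by omega) (by omega)
        simp only [hq', zero_add] at hup ⊢
        nlinarith [mul_le_mul_of_nonneg_left hup hp0,
          mul_le_mul_of_nonneg_left this (sub_nonneg.2 hp1)]
    · have hmono : walkTail t c (z - 1) ≤ walkTail t c (z + 1) := by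
        simpa using ih (z - 1) (z + 1) 0 (by omega) (by omega)
      rcases hle.eq_or_lt with heq | hlt
      · exact average_le_average hp0 hp1 (upProb_anti (by omega)) hup
          (ih (x - 1) (z - 1) k (by omega) (by omega)) hmono
      · have h1 := ih (x + 1) (z - 1) k (by omega) (by omega)
        rcases Nat.eq_zero_or_pos x with rfl | hx
        · have hp' : p = 1 := by simp [hp]
          rw [hp']
          nlinarith [mul_nonneg hq0 (sub_nonneg.2 hmono)]
        · have h2 := ih (x - 1) (z - 1) k (by omega) (by omega)
          nlinarith [mul_nonneg hq0 (sub_nonneg.2 hmono), mul_le_mul_of_nonneg_left h1 hp0,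
            mul_le_mul_of_nonneg_left h2 (sub_nonneg.2 hp1)]

lemma extendWalk_of_le {h : ℕ → ℕ} {N x i : ℕ} (hi : i ≤ N) : extendWalk h N x i = h i := by
  simp [extendWalk, hi]

@[simp] lemma extendWalk_succ (h : ℕ → ℕ) (N x : ℕ) : extendWalk h N x (N + 1) = x := by
  simp [extendWalk]

lemma IsWalk.extendWalk {h : ℕ → ℕ} (hh : IsWalk h) {N x : ℕ} (hx : |(x : ℤ) - h N| = 1) :
    IsWalk (extendWalk h N x) := by
  refine ⟨by simp [_root_.extendWalk, hh.1], fun n => ?_⟩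
  rcases lt_trichotomy n N with hn | rfl | hn
  · rw [extendWalk_of_le (by omega), extendWalk_of_le hn.le]
    exact hh.2 n
  · rw [extendWalk_of_le le_rfl, extendWalk_succ]
    exact hx
  · have h1 : ¬ n + 1 ≤ N := by omega
    have h2 : ¬ n ≤ N := by omega
    simp only [_root_.extendWalk, h1, h2, if_false]
    rw [show x + (n + 1 - (N + 1)) = x + (n - (N + 1)) + 1 by omega]
    simp

lemma IsWalk.succ_eq {h : ℕ → ℕ} (hh : IsWalk h) (n : ℕ) :
    h (n + 1) = h n + 1 ∨ h n = h (n + 1) + 1 := by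
  rcases (abs_eq zero_le_one).1 (hh.2 n) with h' | h' <;> omega

lemma mem_walkCylinder_extendWalk {h g : ℕ → ℕ} {N x : ℕ} :
    g ∈ walkCylinder (N + 1) (extendWalk h N x) ↔ g ∈ walkCylinder N h ∧ g (N + 1) = x := by
  constructor
  · intro hg
    refine ⟨fun i h1 h2 => ?_, ?_⟩
    · rw [hg i h1 (by omega), extendWalk_of_le h2]
    · rw [hg (N + 1) (by omega) le_rfl, extendWalk_succ]
  · rintro ⟨hg, hx⟩ i h1 h2
    rcases h2.eq_or_lt with rfl | h2
    · rw [hx, extendWalk_succ]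
    · rw [hg i h1 (by omega), extendWalk_of_le (by omega)]

lemma IsWalk.eq_of_mem_walkCylinder {h g : ℕ → ℕ} {N : ℕ} (hh : IsWalk h) (hg : IsWalk g)
    (hgN : g ∈ walkCylinder N h) : g N = h N := by
  rcases Nat.eq_zero_or_pos N with rfl | hN
  · rw [hg.1, hh.1]
  · exact hgN N hN le_rfl

lemma measurableSet_isWalk : MeasurableSet {h : ℕ → ℕ | IsWalk h} := by
  have : {h : ℕ → ℕ | IsWalk h} = {h | h 0 = 0} ∩
      ⋂ n : ℕ, (fun h : ℕ → ℕ => (h (n + 1), h n)) ⁻¹'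
        {p : ℕ × ℕ | |(p.1 : ℤ) - (p.2 : ℤ)| = 1} := by
    ext h
    simp [IsWalk]
  rw [this]
  refine (measurableSet_eq_fun (measurable_pi_apply 0) measurable_const).inter
    (MeasurableSet.iInter fun n => ?_)
  exact ((measurable_pi_apply (n + 1)).prodMk (measurable_pi_apply n))
    (Set.to_countable _).measurableSet

section Law

variable {π : Measure (ℕ → ℕ)} [IsProbabilityMeasure π]

/-- A cylinder splits, up to a null set, according to the direction of the next step. -/
lemma measureReal_walkCylinder_inter (hae : ∀ᵐ g ∂π, IsWalk g) {h : ℕ → ℕ} (hh : IsWalk h)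
    (N : ℕ) (A : Set (ℕ → ℕ)) :
    π.real (walkCylinder N h ∩ A) =
      π.real (walkCylinder (N + 1) (extendWalk h N (h N + 1)) ∩ A) +
        if h N = 0 then 0 else π.real (walkCylinder (N + 1) (extendWalk h N (h N - 1)) ∩ A) := by
  have hmeas : MeasurableSet {g : ℕ → ℕ | g (N + 1) = h N + 1} :=
    measurableSet_eq_fun (measurable_pi_apply _) measurable_const
  rw [← measureReal_inter_add_sdiff (s := walkCylinder N h ∩ A) hmeas]
  congr 1
  · congr 1
    ext g
    simp only [Set.mem_inter_iff, Set.mem_ofPred_eq, mem_walkCylinder_extendWalk]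
    tauto
  · split_ifs with h0
    · rw [← measureReal_empty (μ := π)]
      refine measureReal_congr ?_
      filter_upwards [hae] with g hg
      refine propext ⟨?_, False.elim⟩
      rintro ⟨⟨hc, -⟩, hne⟩
      have h1 := hh.eq_of_mem_walkCylinder hg hc
      have h2 : g (N + 1) ≠ h N + 1 := hne
      rcases hg.succ_eq N with h3 | h3 <;> omega
    · refine measureReal_congr ?_
      filter_upwards [hae] with g hg
      refine propext ?_
      change (g ∈ walkCylinder N h ∧ g ∈ A) ∧ ¬ g (N + 1) = h N + 1 ↔
        g ∈ walkCylinder (N + 1) (extendWalk h N (h N - 1)) ∧ g ∈ A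
      rw [mem_walkCylinder_extendWalk]
      constructor
      · rintro ⟨⟨hc, hA⟩, hne⟩
        have h1 := hh.eq_of_mem_walkCylinder hg hc
        refine ⟨⟨hc, ?_⟩, hA⟩
        rcases hg.succ_eq N with h3 | h3 <;> omega
      · rintro ⟨⟨hc, hx⟩, hA⟩
        exact ⟨⟨hc, hA⟩, by omega⟩

lemma IsWalk.extendWalk_up {h : ℕ → ℕ} (hh : IsWalk h) (N : ℕ) :
    IsWalk (_root_.extendWalk h N (h N + 1)) :=
  hh.extendWalk (by simp)

lemma IsWalk.extendWalk_down {h : ℕ → ℕ} (hh : IsWalk h) {N : ℕ} (h0 : h N ≠ 0) :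
    IsWalk (_root_.extendWalk h N (h N - 1)) :=
  hh.extendWalk (by rw [abs_eq zero_le_one]; omega)

/-- The Markov property: given the path up to time `N`, the tail of `X_{N+t}` is `walkTail`. -/
lemma measureReal_walkCylinder_inter_tail (hae : ∀ᵐ g ∂π, IsWalk g)
    (hcyl : ∀ N h, IsWalk h → π.real (walkCylinder N h) = ((h N : ℝ) + 1) / 2 ^ N) (a : ℝ) (t : ℕ) :
    ∀ (N : ℕ) (h : ℕ → ℕ), IsWalk h →
      π.real (walkCylinder N h ∩ {g | a ≤ (g (N + t) : ℝ)}) =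
        ((h N : ℝ) + 1) / 2 ^ N * walkTail t a (h N) := by
  induction t with
  | zero =>
    intro N h hh
    have key : π.real (walkCylinder N h ∩ {g | a ≤ (g (N + 0) : ℝ)}) =
        π.real (walkCylinder N h ∩ {_g | a ≤ (h N : ℝ)}) := by
      refine measureReal_congr ?_
      filter_upwards [hae] with g hg
      refine propext (and_congr_right fun hc => ?_)
      change a ≤ (g N : ℝ) ↔ a ≤ (h N : ℝ)
      rw [hh.eq_of_mem_walkCylinder hg hc]
    rw [key, walkTail]
    split_ifs with ha
    · simp [ha, hcyl N h hh]
    · simp [ha]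
  | succ t ih =>
    intro N h hh
    have hN : N + (t + 1) = N + 1 + t := by omega
    rw [measureReal_walkCylinder_inter hae hh, hN, ih _ _ (hh.extendWalk_up N), walkTail]
    simp only [extendWalk_succ]
    split_ifs with h0
    · simp only [h0]
      push_cast
      field_simp
      ring
    · rw [ih _ _ (hh.extendWalk_down h0), extendWalk_succ, Nat.cast_sub (by omega)]
      push_cast
      field_simp
      ring

/-- Given the path up to time `N ≤ m`, the increment `X_{m+t} - X_m` is dominated by `X_t`. -/
lemma measureReal_walkCylinder_inter_increment_le (hae : ∀ᵐ g ∂π, IsWalk g)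
    (hcyl : ∀ N h, IsWalk h → π.real (walkCylinder N h) = ((h N : ℝ) + 1) / 2 ^ N)
    (c : ℝ) (t d : ℕ) :
    ∀ (N : ℕ) (h : ℕ → ℕ), IsWalk h →
      π.real (walkCylinder N h ∩ {g | c ≤ (g (N + d + t) : ℝ) - (g (N + d) : ℝ)}) ≤
        ((h N : ℝ) + 1) / 2 ^ N * walkTail t c 0 := by
  induction d with
  | zero =>
    intro N h hh
    have key : π.real (walkCylinder N h ∩ {g | c ≤ (g (N + 0 + t) : ℝ) - (g (N + 0) : ℝ)}) =
        π.real (walkCylinder N h ∩ {g | c + (h N : ℝ) ≤ (g (N + t) : ℝ)}) := by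
      refine measureReal_congr ?_
      filter_upwards [hae] with g hg
      refine propext (and_congr_right fun hc => ?_)
      change c ≤ (g (N + t) : ℝ) - (g N : ℝ) ↔ c + (h N : ℝ) ≤ (g (N + t) : ℝ)
      rw [hh.eq_of_mem_walkCylinder hg hc, le_sub_iff_add_le]
    rw [key, measureReal_walkCylinder_inter_tail hae hcyl _ _ _ _ hh]
    exact mul_le_mul_of_nonneg_left (walkTail_le c t _ _ _ (by omega) (by omega)) (by positivity)
  | succ d ih =>
    intro N h hh
    have hN : N + (d + 1) = N + 1 + d := by omega
    rw [measureReal_walkCylinder_inter hae hh, hN]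
    have hup := ih (N + 1) _ (hh.extendWalk_up N)
    rw [extendWalk_succ] at hup
    split_ifs with h0
    · refine (add_le_add hup le_rfl).trans (le_of_eq ?_)
      simp only [h0]
      push_cast
      field_simp
      ring
    · have hdown := ih (N + 1) _ (hh.extendWalk_down h0)
      rw [extendWalk_succ, Nat.cast_sub (by omega)] at hdown
      refine (add_le_add hup hdown).trans (le_of_eq ?_)
      push_cast
      field_simp
      ring

end Law

/-- Stochastic domination of the positive part of the increment `X_n - X_m` by the
positive part of `X_{n-m}`: for `n ≥ m` and `c ≥ 0`,
`π(X_n - X_m ≥ c) ≤ π(X_{n-m} ≥ c)`. -/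
theorem stmt9 (π : Measure (ℕ → ℕ)) [IsProbabilityMeasure π]
    (hsupp : π {h : ℕ → ℕ | h 0 = 0 ∧ ∀ n : ℕ, |((h (n + 1) : ℤ)) - (h n : ℤ)| = 1} = 1)
    (hcyl : ∀ N : ℕ, 1 ≤ N → ∀ h : ℕ → ℕ, h 0 = 0 →
      (∀ n : ℕ, |((h (n + 1) : ℤ)) - (h n : ℤ)| = 1) →
      π {g : ℕ → ℕ | ∀ i, 1 ≤ i → i ≤ N → g i = h i} = ((h N : ℝ≥0∞) + 1) / 2 ^ N)
    (n m : ℕ) (hmn : m ≤ n) (c : ℝ) (hc : 0 ≤ c) :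
    π {h : ℕ → ℕ | c ≤ (h n : ℝ) - (h m : ℝ)} ≤ π {h : ℕ → ℕ | c ≤ (h (n - m) : ℝ)} := by
  have hae : ∀ᵐ g ∂π, IsWalk g :=
    (mem_ae_iff_prob_eq_one measurableSet_isWalk).2 hsupp
  have cylinder_zero (h : ℕ → ℕ) : walkCylinder 0 h = Set.univ := by
    ext g
    simp only [walkCylinder, Set.mem_ofPred_eq, Set.mem_univ, iff_true]
    intro i h1 h2
    omega
  have hcyl' : ∀ N h, IsWalk h → π.real (walkCylinder N h) = ((h N : ℝ) + 1) / 2 ^ N := by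
    intro N h hh
    rcases Nat.eq_zero_or_pos N with rfl | hN
    · simp [cylinder_zero, hh.1]
    · have := congrArg ENNReal.toReal (hcyl N hN h hh.1 hh.2)
      rw [ENNReal.toReal_div, ENNReal.toReal_add (by simp) (by simp)] at this
      simpa [measureReal_def, walkCylinder] using this
  have hid : IsWalk id := ⟨rfl, fun n => by simp⟩
  obtain ⟨t, rfl⟩ := Nat.exists_eq_add_of_le hmn
  have h1 := measureReal_walkCylinder_inter_increment_le hae hcyl' c t m 0 id hid
  have h2 := measureReal_walkCylinder_inter_tail hae hcyl' c t 0 id hid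
  simp only [cylinder_zero, Set.univ_inter, zero_add, id] at h1 h2
  rw [Nat.add_sub_cancel_left]
  refine (ENNReal.toReal_le_toReal (measure_ne_top _ _) (measure_ne_top _ _)).1 ?_
  exact h1.trans h2.ge
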